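/- Let d ≥ 1, p ∈ ℕ, t_0 ∈ ℝ, and let m ∈ ℂ[x_1, …, x_d] be a polynomial of total degree at most 2p. Define q(x, t) := Σ_{k=0}^{p} ( (i (t − t_0) / 2)^k / k! ) (Δ_x^k m)(x), where Δ_x^k denotes the k-fold Laplacian. Then q is a polynomial in (x, t) of total degree at most 2p, satisfies i ∂_t q + (1/2) Δ_x q = 0 identically, and q(x, t_0) = m(x) for all x ∈ ℝ^d. -/

import Mathlib

noncomputable section

open MvPolynomial

/-- The Laplacian `Δ_x` on polynomials in the space variables. -/
def lap (d : ℕ) (m : MvPolynomial (Fin d) ℂ) : MvPolynomial (Fin d) ℂ :=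
  ∑ ℓ : Fin d, pderiv ℓ (pderiv ℓ m)

/-- The Trefftz lift `q(x, t) = Σ_{k=0}^{p} ((i (t − t_0)/2)^k / k!) (Δ_x^k m)(x)` of a
polynomial `m` in the space variables (variable `some ℓ` is `x_ℓ`, variable `none` is `t`). -/
def trefftzLift (d p : ℕ) (t₀ : ℝ) (m : MvPolynomial (Fin d) ℂ) :
    MvPolynomial (Option (Fin d)) ℂ :=
  ∑ k ∈ Finset.range (p + 1),
    C ((Complex.I / 2) ^ k / (k.factorial : ℂ)) * (X none - C ((t₀ : ℝ) : ℂ)) ^ k *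
      rename some ((lap d)^[k] m)

theorem totalDegree_pderiv_le {σ R : Type*} [CommSemiring R] (i : σ) (f : MvPolynomial σ R) :
    (pderiv i f).totalDegree ≤ f.totalDegree - 1 := by
  refine Finset.sup_le fun s hs => ?_
  have h : s + Finsupp.single i 1 ∈ f.support := by
    rw [mem_support_iff, coeff_pderiv] at hs
    exact mem_support_iff.2 (left_ne_zero_of_mul hs)
  have h' := le_totalDegree h
  rw [Finsupp.sum_add_index' (fun _ => rfl) (fun _ _ _ => rfl),
    Finsupp.sum_single_index rfl] at h'
  omega

theorem totalDegree_lap_le (d : ℕ) (m : MvPolynomial (Fin d) ℂ) :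
    (lap d m).totalDegree ≤ m.totalDegree - 2 := by
  refine totalDegree_finsetSum_le fun ℓ _ => ?_
  have h₁ := totalDegree_pderiv_le ℓ m
  have h₂ := totalDegree_pderiv_le ℓ (pderiv ℓ m)
  omega

theorem totalDegree_lap_iterate_le (d k : ℕ) (m : MvPolynomial (Fin d) ℂ) :
    ((lap d)^[k] m).totalDegree ≤ m.totalDegree - 2 * k := by
  induction k with
  | zero => simp
  | succ k ih =>
    rw [Function.iterate_succ_apply']
    have h := totalDegree_lap_le d ((lap d)^[k] m)
    omega

theorem lap_iterate_succ_eq_zero {d p : ℕ} {m : MvPolynomial (Fin d) ℂ}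
    (hm : m.totalDegree ≤ 2 * p) : (lap d)^[p + 1] m = 0 := by
  have h := totalDegree_lap_iterate_le d p m
  have h₀ : ((lap d)^[p] m).totalDegree = 0 := by omega
  rw [Function.iterate_succ_apply', totalDegree_eq_zero_iff_eq_C.1 h₀]
  simp [lap]

theorem totalDegree_trefftzLift_le {d p : ℕ} (t₀ : ℝ) {m : MvPolynomial (Fin d) ℂ}
    (hm : m.totalDegree ≤ 2 * p) : (trefftzLift d p t₀ m).totalDegree ≤ 2 * p := by
  refine totalDegree_finsetSum_le fun k hk => ?_
  have hk' := Finset.mem_range.1 hk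
  have hL := (totalDegree_rename_le some ((lap d)^[k] m)).trans
    (totalDegree_lap_iterate_le d k m)
  have hT : ((X none - C (t₀ : ℂ) : MvPolynomial (Option (Fin d)) ℂ) ^ k).totalDegree ≤ k := by
    refine (totalDegree_pow _ _).trans ?_
    have h := totalDegree_sub_C_le (X none : MvPolynomial (Option (Fin d)) ℂ) (t₀ : ℂ)
    rw [totalDegree_X] at h
    exact (Nat.mul_le_mul_left k h).trans_eq (mul_one k)
  refine (totalDegree_mul _ _).trans ((Nat.add_le_add_right (totalDegree_mul _ _) _).trans ?_)
  rw [totalDegree_C]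
  omega

theorem pderiv_none_rename_some {σ R : Type*} [CommSemiring R] (f : MvPolynomial σ R) :
    pderiv none (rename some f) = 0 := by
  classical
  refine pderiv_eq_zero_of_notMem_vars fun h => ?_
  obtain ⟨_, _, h'⟩ := Finset.mem_image.1 (vars_rename some f h)
  exact Option.some_ne_none _ h'

theorem pderiv_none_term (d k : ℕ) (a t : ℂ) (f : MvPolynomial (Fin d) ℂ) :
    pderiv none (C a * (X none - C t) ^ k * rename some f) =
      C (a * k) * (X none - C t) ^ (k - 1) * rename some f := by
  rw [pderiv_mul, pderiv_none_rename_some, pderiv_C_mul, pderiv_pow, map_sub, pderiv_X_self,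
    pderiv_C, C_mul, map_natCast]
  ring

theorem pderiv_some_term (d k : ℕ) (a t : ℂ) (f : MvPolynomial (Fin d) ℂ) (ℓ : Fin d) :
    pderiv (some ℓ) (C a * (X none - C t) ^ k * rename some f) =
      C a * (X none - C t) ^ k * rename some (pderiv ℓ f) := by
  rw [pderiv_mul, pderiv_rename (Option.some_injective _), pderiv_C_mul, pderiv_pow, map_sub,
    pderiv_X_of_ne (Option.some_ne_none ℓ).symm, pderiv_C]
  ring

theorem pderiv_none_trefftzLift (d p : ℕ) (t₀ : ℝ) (m : MvPolynomial (Fin d) ℂ) :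
    pderiv none (trefftzLift d p t₀ m) =
      ∑ k ∈ Finset.range p,
        C (Complex.I / 2 * ((Complex.I / 2) ^ k / (k.factorial : ℂ))) *
          (X none - C (t₀ : ℂ)) ^ k * rename some ((lap d)^[k + 1] m) := by
  simp only [trefftzLift, map_sum, pderiv_none_term]
  rw [Finset.sum_range_succ']
  simp only [Nat.cast_zero, mul_zero, C_0, zero_mul, add_zero, Nat.add_sub_cancel]
  refine Finset.sum_congr rfl fun k _ => ?_
  congr 3
  rw [Nat.factorial_succ]
  have h₁ : (k.factorial : ℂ) ≠ 0 := Nat.cast_ne_zero.2 k.factorial_ne_zero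
  have h₂ : ((k + 1 : ℕ) : ℂ) ≠ 0 := Nat.cast_ne_zero.2 k.succ_ne_zero
  rw [Nat.cast_mul]
  field_simp
  ring

theorem laplacian_trefftzLift {d p : ℕ} (t₀ : ℝ) {m : MvPolynomial (Fin d) ℂ}
    (hm : m.totalDegree ≤ 2 * p) :
    ∑ ℓ : Fin d, pderiv (some ℓ) (pderiv (some ℓ) (trefftzLift d p t₀ m)) =
      ∑ k ∈ Finset.range p,
        C ((Complex.I / 2) ^ k / (k.factorial : ℂ)) *
          (X none - C (t₀ : ℂ)) ^ k * rename some ((lap d)^[k + 1] m) := by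
  simp only [trefftzLift, map_sum, pderiv_some_term]
  rw [Finset.sum_comm]
  simp only [← Finset.mul_sum, ← map_sum]
  change ∑ k ∈ Finset.range (p + 1), _ * rename some (lap d ((lap d)^[k] m)) = _
  simp only [← Function.iterate_succ_apply' (lap d)]
  rw [Finset.sum_range_succ, Nat.succ_eq_add_one, lap_iterate_succ_eq_zero hm, map_zero, mul_zero,
    add_zero]

theorem eval_trefftzLift (d p : ℕ) (t₀ : ℝ) (m : MvPolynomial (Fin d) ℂ) (x : Fin d → ℂ) :
    eval (fun v => v.elim (t₀ : ℂ) x) (trefftzLift d p t₀ m) = eval x m := by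
  rw [trefftzLift, map_sum, Finset.sum_range_succ', Finset.sum_eq_zero, zero_add]
  · simp [eval_rename, Function.comp_def]
  · intro k _
    simp

/-- For `m` of total degree at most `2p`, the polynomial
`q(x, t) = Σ_{k=0}^{p} ((i (t − t_0)/2)^k / k!) (Δ_x^k m)(x)`
has total degree at most `2p`, satisfies `i ∂_t q + (1/2) Δ_x q = 0`, and restricts to `m` at
`t = t_0`. -/
theorem trefftzLift_spec (d p : ℕ) (hd : 1 ≤ d) (t₀ : ℝ) (m : MvPolynomial (Fin d) ℂ)
    (hm : m.totalDegree ≤ 2 * p) :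
    (trefftzLift d p t₀ m).totalDegree ≤ 2 * p ∧
    (Complex.I • pderiv (none : Option (Fin d)) (trefftzLift d p t₀ m)
      + (1/2 : ℂ) • ∑ ℓ : Fin d,
          pderiv (some ℓ) (pderiv (some ℓ) (trefftzLift d p t₀ m)) = 0) ∧
    ∀ x : Fin d → ℝ,
      MvPolynomial.eval (fun v => v.elim ((t₀ : ℝ) : ℂ) (fun ℓ => ((x ℓ : ℝ) : ℂ)))
          (trefftzLift d p t₀ m)
        = MvPolynomial.eval (fun ℓ => ((x ℓ : ℝ) : ℂ)) m := by
  refine ⟨totalDegree_trefftzLift_le t₀ hm, ?_, fun x => eval_trefftzLift d p t₀ m _⟩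
  rw [pderiv_none_trefftzLift, laplacian_trefftzLift t₀ hm, Finset.smul_sum, Finset.smul_sum,
    ← Finset.sum_add_distrib]
  refine Finset.sum_eq_zero fun k _ => ?_
  have h : Complex.I * (Complex.I / 2) + 1 / 2 = 0 := by
    rw [mul_div_assoc', Complex.I_mul_I]
    norm_num
  rw [C_mul, mul_assoc, mul_assoc, ← smul_eq_C_mul, smul_smul, ← mul_assoc, ← add_smul, h,
    zero_smul]
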